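/- For every walk-based +-compatible semantics S, there exists a filter-based semantics S′ such that for every database D, regular expression R and walk w of positive length: w ∈ S(D,R) if and only if w ∈ S′(D,R). -/

import Mathlib

namespace RPQ

/-- Vertex identifiers. -/
abbrev V : Type := ℕ
/-- Edge identifiers. -/
abbrev Edg : Type := ℕ
/-- Labels. -/
abbrev Lab : Type := ℕ

/-- A walk: a nonempty alternating sequence `v₀,e₁,v₁,…,e_k,v_k`, encoded as the
initial vertex together with the list of (edge, next-vertex) pairs. -/
structure Walk where
  head : V
  steps : List (Edg × V)
deriving DecidableEq

namespace Walk

def length (w : Walk) : ℕ := w.steps.length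
def src (w : Walk) : V := w.head
def tgt (w : Walk) : V := (w.steps.map Prod.snd).getLastD w.head
/-- The pair of endpoints of a walk. -/
def ep (w : Walk) : V × V := (w.src, w.tgt)
def vertexList (w : Walk) : List V := w.head :: w.steps.map Prod.snd
def edgeList (w : Walk) : List Edg := w.steps.map Prod.fst
/-- Concatenation of walks (meaningful when `w.tgt = w'.src`). -/
def concat (w w' : Walk) : Walk := ⟨w.head, w.steps ++ w'.steps⟩

end Walk

/-- A graph database. -/
structure Database where
  labels : Finset Lab
  verts : Finset V
  edges : Finset Edg
  src : Edg → V
  tgt : Edg → V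
  lbl : Edg → Lab
  src_mem : ∀ e ∈ edges, src e ∈ verts
  tgt_mem : ∀ e ∈ edges, tgt e ∈ verts
  lbl_mem : ∀ e ∈ edges, lbl e ∈ labels

def chainFrom (D : Database) : V → List (Edg × V) → Prop
  | _, [] => True
  | v, (e, v') :: rest =>
      e ∈ D.edges ∧ D.src e = v ∧ D.tgt e = v' ∧ chainFrom D v' rest

/-- `w` is consistent with `D`, i.e. `w` is a walk in `D`. -/
def Walk.Consistent (D : Database) (w : Walk) : Prop :=
  w.head ∈ D.verts ∧ chainFrom D w.head w.steps

/-- The set of walks in `D`. -/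
def Walks (D : Database) : Set Walk := {w | w.Consistent D}

/-- The label of a walk in `D`: the word of its successive edge labels. -/
def Walk.label (D : Database) (w : Walk) : List Lab :=
  w.steps.map fun p => D.lbl p.1

abbrev RE := RegularExpression Lab

/-- Matches of `R` in `D`: walks in `D` whose label conforms to `R`. -/
def Matches (D : Database) (R : RE) : Set Walk :=
  {w | w.Consistent D ∧ w.label D ∈ R.matches'}

/-- A semantics maps a database and a query to a finite subset of its matches. -/
def IsSemantics (S : Database → RE → Set Walk) : Prop :=
  ∀ D R, S D R ⊆ Matches D R ∧ (S D R).Finite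

/-- `S` is walk-based. -/
def WalkBased (S : Database → RE → Set Walk) : Prop :=
  ∃ r : Set Walk → Set Walk, ∀ D R, S D R = r (Matches D R)

/-- The semantics defined by a filter `f`. -/
def FilterSem (f : Walk → Bool) (D : Database) (R : RE) : Set Walk :=
  {w ∈ Matches D R | f w = true}

/-- Componentwise inclusion of databases. -/
def Database.Sub (D D' : Database) : Prop :=
  D.labels ⊆ D'.labels ∧ D.verts ⊆ D'.verts ∧ D.edges ⊆ D'.edges ∧
    ∀ e ∈ D.edges, D'.src e = D.src e ∧ D'.tgt e = D.tgt e ∧ D'.lbl e = D.lbl e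

def IsPartialOrderRel (le : Walk → Walk → Prop) : Prop :=
  (∀ w, le w w) ∧ (∀ a b c, le a b → le b c → le a c) ∧ ∀ a b, le a b → le b a → a = b

/-- `le` is a well-partial-order on the walks of `D`. -/
def IsWpoOn (le : Walk → Walk → Prop) (D : Database) : Prop :=
  ∀ f : ℕ → Walk, (∀ n, (f n).Consistent D) → ∃ i j, i < j ∧ le (f i) (f j)

/-- Suitable order: a partial order on walks that is a wpo on `Walks D` for each `D`. -/
def Suitable (le : Walk → Walk → Prop) : Prop :=
  IsPartialOrderRel le ∧ ∀ D, IsWpoOn le D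

/-- The semantics based on the order `le`: the `le`-minimal matches among those
with the same endpoints. -/
def OrderSem (le : Walk → Walk → Prop) (D : Database) (R : RE) : Set Walk :=
  {w ∈ Matches D R | ∀ w' ∈ Matches D R, w'.ep = w.ep → le w' w → w' = w}

def Monotonous (S : Database → RE → Set Walk) : Prop :=
  ∀ D D' R, D.Sub D' → S D R ⊆ S D' R

def CoMonotonous (S : Database → RE → Set Walk) : Prop :=
  ∀ D D' R, D.Sub D' → S D' R ∩ Walks D ⊆ S D R

def Stabilizing (S : Database → RE → Set Walk) : Prop :=
  ∀ (D : Database) (Rs : ℕ → RE),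
    (∀ i j, i ≤ j → ∀ u, u ∈ (Rs i).matches' → u ∈ (Rs j).matches') →
    ∃ N, ∀ n, N ≤ n → S D (Rs n) = S D (Rs N)

/-- Concatenation lifted to sets of walks. -/
def setConcat (W W' : Set Walk) : Set Walk :=
  {u | ∃ w ∈ W, ∃ w' ∈ W', w.tgt = w'.src ∧ u = w.concat w'}

/-- `setStar W` : all concatenations `w₁·…·w_k` (k ≥ 1) of walks of `W`. -/
inductive setStar (W : Set Walk) : Walk → Prop
  | base : ∀ w ∈ W, setStar W w
  | step : ∀ u w, setStar W u → w ∈ W → u.tgt = w.src → setStar W (u.concat w)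

/-- Walks jointly consistent with some database. -/
def ConsistentPair (w w' : Walk) : Prop :=
  ∃ D : Database, w.Consistent D ∧ w'.Consistent D

/-- The trimming of an order. -/
def trimRel (le : Walk → Walk → Prop) (w w' : Walk) : Prop :=
  ConsistentPair w w' ∧ w.ep = w'.ep ∧ le w w'

def Trimmed (le : Walk → Walk → Prop) : Prop := trimRel le = le

/-- `le` respects element inclusion. -/
def RespectsElemIncl (le : Walk → Walk → Prop) : Prop :=
  ∀ w w', le w w' →
    (∀ v ∈ w.vertexList, v ∈ w'.vertexList) ∧ ∀ e ∈ w.edgeList, e ∈ w'.edgeList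

/-- Action of a relabeling on a database. -/
def Database.relabel (π : Equiv.Perm Lab) (D : Database) : Database where
  labels := D.labels.image (⇑π)
  verts := D.verts
  edges := D.edges
  src := D.src
  tgt := D.tgt
  lbl := fun e => π (D.lbl e)
  src_mem := D.src_mem
  tgt_mem := D.tgt_mem
  lbl_mem := fun e he => Finset.mem_image_of_mem (⇑π) (D.lbl_mem e he)

/-- Action of a renaming on a walk. -/
def Walk.rename (νv : Equiv.Perm V) (νe : Equiv.Perm Edg) (w : Walk) : Walk :=
  ⟨νv w.head, w.steps.map fun p => (νe p.1, νv p.2)⟩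

/-- Action of a renaming on a database. -/
def Database.rename (νv : Equiv.Perm V) (νe : Equiv.Perm Edg) (D : Database) :
    Database where
  labels := D.labels
  verts := D.verts.image (⇑νv)
  edges := D.edges.image (⇑νe)
  src := fun e => νv (D.src (νe.symm e))
  tgt := fun e => νv (D.tgt (νe.symm e))
  lbl := fun e => D.lbl (νe.symm e)
  src_mem := by
    intro e he
    obtain ⟨e', he', rfl⟩ := Finset.mem_image.mp he
    simpa using Finset.mem_image_of_mem (⇑νv) (D.src_mem e' he')
  tgt_mem := by
    intro e he
    obtain ⟨e', he', rfl⟩ := Finset.mem_image.mp he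
    simpa using Finset.mem_image_of_mem (⇑νv) (D.tgt_mem e' he')
  lbl_mem := by
    intro e he
    obtain ⟨e', he', rfl⟩ := Finset.mem_image.mp he
    simpa using D.lbl_mem e' he'

/-- Identifier independence. -/
def IdIndependent (S : Database → RE → Set Walk) : Prop :=
  ∀ (νv : Equiv.Perm V) (νe : Equiv.Perm Edg) (D : Database) (R : RE),
    Walk.rename νv νe '' S D R = S (Database.rename νv νe D) R

/-- Unbounded semantics. -/
def Unbounded (S : Database → RE → Set Walk) : Prop :=
  ∀ n : ℕ, ∃ (D : Database) (R : RE) (w : Walk), w ∈ S D R ∧ n ≤ w.length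

/-- Shortest-walk semantics. -/
def Sh (D : Database) (R : RE) : Set Walk :=
  {w ∈ Matches D R | ∀ w' ∈ Matches D R, w'.ep = w.ep → w.length ≤ w'.length}

/-- The factor-inserting relation `F`. -/
def FactorIns (w w' : Walk) : Prop :=
  ∃ w₁ w₂ w₃ : Walk, w₁.tgt = w₂.src ∧ w₂.tgt = w₃.src ∧ w₁.tgt = w₃.src ∧
    w = w₁.concat w₃ ∧ w' = (w₁.concat w₂).concat w₃

/-- The subwalk order: reflexive–transitive closure of `FactorIns`. -/
def SubwalkOrd : Walk → Walk → Prop := Relation.ReflTransGen FactorIns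

theorem mem_matches'_list_sum (l : List RE) (v : List Lab) :
    v ∈ l.sum.matches' ↔ ∃ R ∈ l, v ∈ R.matches' := by
  induction l with
  | nil => simp [Language.notMem_zero]
  | cons R l ih => simp [Language.mem_add, ih]

theorem mem_matches'_char (a : Lab) (v : List Lab) :
    v ∈ (RegularExpression.char a : RE).matches' ↔ v = [a] := by
  rw [RegularExpression.matches'_char]
  exact Set.mem_singleton_iff

theorem mem_matches'_char_mul (a : Lab) (R : RE) (v : List Lab) :
    v ∈ (RegularExpression.char a * R).matches' ↔ ∃ t ∈ R.matches', v = a :: t := by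
  simp only [RegularExpression.matches'_mul, Language.mem_mul, mem_matches'_char]
  constructor
  · rintro ⟨_, rfl, t, ht, rfl⟩
    exact ⟨t, ht, rfl⟩
  · rintro ⟨t, ht, rfl⟩
    exact ⟨[a], rfl, t, ht, rfl⟩

theorem cons_mem_matches'_iff_deriv (R : RE) (a : Lab) (v : List Lab) :
    a :: v ∈ R.matches' ↔ v ∈ (R.deriv a).matches' := by
  rw [← RegularExpression.rmatch_iff_matches', ← RegularExpression.rmatch_iff_matches']
  rfl

/-- On words over a finite alphabet, a single word can be removed from a regular language. -/
theorem exists_matches'_diff_singleton (A : List Lab) (u : List Lab) (R : RE) :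
    ∃ R' : RE, ∀ v : List Lab, (∀ a ∈ v, a ∈ A) →
      (v ∈ R'.matches' ↔ v ∈ R.matches' ∧ v ≠ u) := by
  induction u generalizing R with
  | nil =>
    refine ⟨(A.map fun a => RegularExpression.char a * R.deriv a).sum, fun v hv => ?_⟩
    simp only [mem_matches'_list_sum, List.mem_map, exists_exists_and_eq_and,
      mem_matches'_char_mul, ← cons_mem_matches'_iff_deriv]
    cases v with
    | nil => simp
    | cons b v =>
      have hb : b ∈ A := hv b (by simp)
      grind
  | cons c u ih =>
    obtain ⟨Q, hQ⟩ := ih (R.deriv c)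
    obtain ⟨N, hN⟩ : ∃ N : RE, ∀ v, v ∈ N.matches' ↔ v = [] ∧ [] ∈ R.matches' := by
      by_cases h : [] ∈ R.matches'
      · exact ⟨1, fun v => by simp [h]⟩
      · exact ⟨0, fun v => by simp [h, Language.notMem_zero]⟩
    refine ⟨N + (A.map fun a => RegularExpression.char a *
      (if a = c then Q else R.deriv a)).sum, fun v hv => ?_⟩
    simp only [RegularExpression.matches'_add, Language.mem_add, hN, mem_matches'_list_sum,
      List.mem_map, exists_exists_and_eq_and, mem_matches'_char_mul]
    cases v with
    | nil => simp
    | cons b v =>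
      have hb : b ∈ A := hv b (by simp)
      have hQv := hQ v fun a ha => hv a (by simp [ha])
      rw [← cons_mem_matches'_iff_deriv] at hQv
      have hd := cons_mem_matches'_iff_deriv R b v
      by_cases hbc : b = c
      · subst hbc
        grind
      · grind

/-- The product of the character classes listed in `cls`. -/
def classWord (cls : List (List Lab)) : RE :=
  (cls.map fun c => (c.map RegularExpression.char).sum).prod

theorem mem_matches'_classWord (cls : List (List Lab)) (v : List Lab) :
    v ∈ (classWord cls).matches' ↔ List.Forall₂ (· ∈ ·) v cls := by
  induction cls generalizing v with
  | nil => simp [classWord, Language.mem_one]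
  | cons c cls ih =>
    have hcons : classWord (c :: cls) = (c.map RegularExpression.char).sum * classWord cls := by
      simp [classWord]
    rw [hcons, RegularExpression.matches'_mul, Language.mem_mul, List.forall₂_cons_right_iff]
    simp only [mem_matches'_list_sum, List.mem_map, exists_exists_and_eq_and,
      mem_matches'_char, ih]
    constructor
    · rintro ⟨_, ⟨a, ha, rfl⟩, t, ht, rfl⟩
      exact ⟨a, t, ha, ht, rfl⟩
    · rintro ⟨a, t, ha, ht, rfl⟩
      exact ⟨[a], ⟨a, ha, rfl⟩, t, ht, rfl⟩

/-- The regular expression matching exactly the word `u`. -/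
def wordRE (u : List Lab) : RE := classWord (u.map fun a => [a])

theorem mem_matches'_wordRE (u v : List Lab) : v ∈ (wordRE u).matches' ↔ v = u := by
  rw [wordRE, mem_matches'_classWord, List.forall₂_map_right_iff]
  simp

theorem chainFrom.edge_mem {D : Database} {v : V} {l : List (Edg × V)} (h : chainFrom D v l) :
    ∀ p ∈ l, p.1 ∈ D.edges := by
  induction l generalizing v with
  | nil => simp
  | cons p l ih =>
    obtain ⟨h1, -, -, h4⟩ := h
    simpa [h1] using ih h4

theorem chainFrom.eq_of_map_fst_eq {D : Database} {v v' : V} {l l' : List (Edg × V)}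
    (h : chainFrom D v l) (h' : chainFrom D v' l') (he : l.map Prod.fst = l'.map Prod.fst) :
    l = l' := by
  induction l generalizing v v' l' with
  | nil => exact (List.map_eq_nil_iff.1 he.symm).symm
  | cons p l ih =>
    cases l' with
    | nil => simp at he
    | cons p' l' =>
      obtain ⟨-, -, h3, h4⟩ := h
      obtain ⟨-, -, h3', h4'⟩ := h'
      simp only [List.map_cons, List.cons.injEq] at he
      rw [ih h4 h4' he.2, Prod.ext he.1 (by rw [← h3, ← h3', he.1])]

/-- In a database, a walk of positive length is determined by its edges. -/
theorem Walk.Consistent.eq_of_edgeList_eq {D : Database} {w w' : Walk} (h : w.Consistent D)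
    (h' : w'.Consistent D) (hpos : 0 < w.length) (he : w.edgeList = w'.edgeList) : w = w' := by
  have hs : w.steps = w'.steps := h.2.eq_of_map_fst_eq h'.2 he
  obtain ⟨v, l⟩ := w
  obtain ⟨v', l'⟩ := w'
  obtain rfl : l = l' := hs
  cases l with
  | nil => simp [Walk.length] at hpos
  | cons p l =>
    obtain rfl : v = v' := h.2.2.1.symm.trans h'.2.2.1
    rfl

/-- The database obtained by labelling each edge by its own identifier. -/
def Database.edgeLabeled (D : Database) : Database where
  labels := D.edges
  verts := D.verts
  edges := D.edges
  src := D.src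
  tgt := D.tgt
  lbl := id
  src_mem := D.src_mem
  tgt_mem := D.tgt_mem
  lbl_mem := fun _ he => he

theorem chainFrom_edgeLabeled (D : Database) (v : V) (l : List (Edg × V)) :
    chainFrom D.edgeLabeled v l ↔ chainFrom D v l := by
  induction l generalizing v with
  | nil => rfl
  | cons p l ih => exact and_congr_right' (and_congr_right' (and_congr_right' (ih _)))

theorem consistent_edgeLabeled (D : Database) (w : Walk) :
    w.Consistent D.edgeLabeled ↔ w.Consistent D :=
  and_congr_right' (chainFrom_edgeLabeled D w.head w.steps)

theorem label_edgeLabeled (D : Database) (w : Walk) : w.label D.edgeLabeled = w.edgeList := rfl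

theorem matches_edgeLabeled_classWord (D : Database) (u : List Lab) :
    Matches D.edgeLabeled (classWord (u.map fun a => D.edges.toList.filter (D.lbl · = a))) =
      Matches D (wordRE u) := by
  ext w
  simp only [Matches, Set.mem_ofPred_eq, consistent_edgeLabeled, mem_matches'_classWord,
    mem_matches'_wordRE, label_edgeLabeled]
  refine and_congr_right fun hw => ?_
  rw [← List.forall₂_eq_eq_eq, Walk.label, Walk.edgeList, List.forall₂_map_left_iff,
    List.forall₂_map_left_iff, List.forall₂_map_right_iff]
  have hmem := hw.2.edge_mem
  generalize w.steps = l at hmem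
  induction l generalizing u with
  | nil => simp
  | cons p l ih =>
    cases u with
    | nil => simp
    | cons a u =>
      have hp := hmem p (by simp)
      rw [List.forall₂_cons, List.forall₂_cons]
      exact and_congr (by simp [hp]) (ih u fun q hq => hmem q (by simp [hq]))

theorem matches_edgeLabeled_wordRE {D : Database} {w : Walk} (hw : w.Consistent D)
    (hpos : 0 < w.length) : Matches D.edgeLabeled (wordRE w.edgeList) = {w} := by
  ext w'
  simp only [Matches, Set.mem_ofPred_eq, consistent_edgeLabeled, mem_matches'_wordRE,
    label_edgeLabeled, Set.mem_singleton_iff]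
  constructor
  · rintro ⟨h, he⟩
    exact (hw.eq_of_edgeList_eq h hpos he.symm).symm
  · rintro rfl
    exact ⟨hw, rfl⟩

theorem Walk.Consistent.label_subset {D : Database} {w : Walk} (hw : w.Consistent D) :
    ∀ a ∈ w.label D, a ∈ D.labels.toList := by
  simp only [Walk.label, List.mem_map, Finset.mem_toList]
  rintro _ ⟨p, hp, rfl⟩
  exact D.lbl_mem _ (hw.2.edge_mem p hp)

/-- A walk-based +-compatible semantics keeps a match of `R` iff it keeps it for the query
consisting of the label of that walk only. -/
theorem mem_semantics_iff_mem_wordRE {S : Database → RE → Set Walk} (hS : IsSemantics S)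
    (hWB : WalkBased S) (hplus : ∀ (D : Database) (R R' : RE), S D (R + R') = S D R ∪ S D R')
    {D : Database} {R : RE} {w : Walk} (hw : w ∈ Matches D R) :
    w ∈ S D R ↔ w ∈ S D (wordRE (w.label D)) := by
  obtain ⟨r, hr⟩ := hWB
  obtain ⟨R', hR'⟩ := exists_matches'_diff_singleton D.labels.toList (w.label D) R
  have hM : Matches D R = Matches D (wordRE (w.label D) + R') := by
    ext x
    simp only [Matches, Set.mem_ofPred_eq, RegularExpression.matches'_add, Language.mem_add,
      mem_matches'_wordRE]
    refine and_congr_right fun hx => ?_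
    rw [hR' _ hx.label_subset]
    by_cases hxw : x.label D = w.label D
    · simpa [hxw] using hw.2
    · simp [hxw]
  have hnot : w ∉ S D R' := fun h =>
    ((hR' _ hw.1.label_subset).1 ((hS D R').1 h).2).2 rfl
  rw [hr D R, hM, ← hr, hplus]
  simp [hnot]

theorem mem_semantics_iff_mem_singleton {S : Database → RE → Set Walk} (hS : IsSemantics S)
    {r : Set Walk → Set Walk} (hr : ∀ D R, S D R = r (Matches D R))
    (hplus : ∀ (D : Database) (R R' : RE), S D (R + R') = S D R ∪ S D R')
    {D : Database} {R : RE} {w : Walk} (hw : w ∈ Matches D R) (hpos : 0 < w.length) :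
    w ∈ S D R ↔ w ∈ r {w} := by
  have hM := matches_edgeLabeled_classWord D (w.label D)
  have hmem : w ∈ Matches D (wordRE (w.label D)) := ⟨hw.1, (mem_matches'_wordRE _ _).2 rfl⟩
  rw [mem_semantics_iff_mem_wordRE hS ⟨r, hr⟩ hplus hw, hr, ← hM, ← hr,
    mem_semantics_iff_mem_wordRE hS ⟨r, hr⟩ hplus (hM ▸ hmem), label_edgeLabeled, hr,
    matches_edgeLabeled_wordRE hw.1 hpos]

/-- For every walk-based +-compatible semantics `S`, there is a filter-based
semantics agreeing with `S` on all walks of positive length. -/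
theorem plusCompatible_agrees_filterBased
    (S : Database → RE → Set Walk) (hS : IsSemantics S) (hWB : WalkBased S)
    (hplus : ∀ (D : Database) (R R' : RE), S D (R + R') = S D R ∪ S D R') :
    ∃ f : Walk → Bool, IsSemantics (FilterSem f) ∧
      ∀ (D : Database) (R : RE) (w : Walk), 0 < w.length →
        (w ∈ S D R ↔ w ∈ FilterSem f D R) := by
  classical
  obtain ⟨r, hr⟩ := hWB
  have key : ∀ (D : Database) (R : RE) (w : Walk), 0 < w.length →
      (w ∈ S D R ↔ w ∈ FilterSem (fun w => decide (0 < w.length ∧ w ∈ r {w})) D R) := by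
    intro D R w hpos
    simp only [FilterSem, Set.mem_ofPred_eq, decide_eq_true_eq]
    constructor
    · intro h
      have hw := (hS D R).1 h
      exact ⟨hw, hpos, (mem_semantics_iff_mem_singleton hS hr hplus hw hpos).1 h⟩
    · rintro ⟨hw, -, h⟩
      exact (mem_semantics_iff_mem_singleton hS hr hplus hw hpos).2 h
  refine ⟨_, fun D R => ⟨fun w hw => hw.1, (hS D R).2.subset fun w hw => ?_⟩, key⟩
  exact (key D R w (of_decide_eq_true hw.2).1).2 hw

end RPQ
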